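/- arXiv:2408.15728 — 2 statements merged into one kernel-verified Lean document; each statement's English description precedes it below -/
import Mathlib

section
/- Let F be an infinite field, and let Λ₁ ⊆ I₁ × J₁ × K₁, …, Λ_p ⊆ I_p × J_p × K_p be nonempty patterns over finite sets, and let Q be a probability distribution on {1,…,p}. If (a,b,c) ∈ Σ_{i=1}^p Q(i)·C(Λ_i) (the Minkowski sum of the scaled capacity regions), then ω_s(a,b,c) ≤ log₂ Ř_s(Φ(Λ₁) + ⋯ + Φ(Λ_p)) − H(Q), where Φ(Λ₁) + ⋯ + Φ(Λ_p) is the block-diagonal direct sum of the supports and H(Q) = −Σ_i Q(i) log₂ Q(i). -/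
open scoped BigOperators

/-- The rank of a tensor `t : I × J × K → F`. -/
noncomputable def TensorRank (F : Type*) [Field F] {I J K : Type*} (t : I × J × K → F) : ℕ :=
  sInf {L : ℕ | ∃ (a : Fin L → I → F) (b : Fin L → J → F) (c : Fin L → K → F),
    ∀ q : I × J × K, t q = ∑ m, a m q.1 * b m q.2.1 * c m q.2.2}

/-- The support rank of `Φ ⊆ I × J × K`. -/
noncomputable def SupportRank (F : Type*) [Field F] {I J K : Type*} (Φ : Set (I × J × K)) : ℕ :=
  sInf (TensorRank F '' {t : I × J × K → F | {q | t q ≠ 0} = Φ})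

/-- The `n`-fold product `Φ^{×n}` of a support `Φ ⊆ I × J × K`. -/
def PowSupport {I J K : Type*} (Φ : Set (I × J × K)) (n : ℕ) :
    Set ((Fin n → I) × (Fin n → J) × (Fin n → K)) :=
  {q | ∀ s : Fin n, (q.1 s, q.2.1 s, q.2.2 s) ∈ Φ}

/-- The asymptotic support rank `Ř_s(Φ) = inf_{n ≥ 1} R_s(Φ^{×n})^{1/n}`. -/
noncomputable def AsymptoticSupportRank (F : Type*) [Field F] {I J K : Type*}
    (Φ : Set (I × J × K)) : ℝ :=
  sInf {x : ℝ | ∃ n : ℕ, 0 < n ∧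
    x = (SupportRank F (PowSupport Φ n) : ℝ) ^ ((1 : ℝ) / n)}

/-- The support of the `l × m × n` matrix multiplication tensor. -/
def MMSupport (l m n : ℕ) :
    Set ((Fin l × Fin m) × (Fin m × Fin n) × (Fin n × Fin l)) :=
  {q | ∃ i j k, q = ((i, j), (j, k), (k, i))}

/-- The rectangular support rank exponent `ω_s(a,b,c)`. -/
noncomputable def omegaS (F : Type*) [Field F] (a b c : ℝ) : ℝ :=
  Filter.limsup (fun n : ℕ =>
    (1 / n : ℝ) * Real.logb 2
      (SupportRank F (MMSupport ⌊(2 : ℝ) ^ (a * n)⌋₊ ⌊(2 : ℝ) ^ (b * n)⌋₊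
        ⌊(2 : ℝ) ^ (c * n)⌋₊))) Filter.atTop

/-- A rate triple `(a, b, c)` is achievable for `Λ`. -/
def Achievable {I J K : Type*} (Λ : Set (I × J × K)) (r : ℝ × ℝ × ℝ) : Prop :=
  0 ≤ r.1 ∧ 0 ≤ r.2.1 ∧ 0 ≤ r.2.2 ∧
  ∀ n : ℕ, 0 < n →
    ∃ (f : (Fin n → I) → Fin ⌊(2 : ℝ) ^ (r.1 * n)⌋₊)
      (g : (Fin n → J) → Fin ⌊(2 : ℝ) ^ (r.2.1 * n)⌋₊)
      (h : (Fin n → K) → Fin ⌊(2 : ℝ) ^ (r.2.2 * n)⌋₊),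
      (fun q : (Fin n → I) × (Fin n → J) × (Fin n → K) =>
        (f q.1, g q.2.1, h q.2.2)) '' PowSupport Λ n = Set.univ

/-- The capacity region of `Λ`: the closure of the set of achievable rate triples. -/
def CapacityRegion {I J K : Type*} (Λ : Set (I × J × K)) : Set (ℝ × ℝ × ℝ) :=
  closure {r : ℝ × ℝ × ℝ | Achievable Λ r}

/-- The block-diagonal direct sum `Φ(Λ₁) + ⋯ + Φ(Λ_p)` of the partial matrix
multiplication supports of a family of patterns. -/
def FamPMMSumSupport {p : ℕ} {I J K : Fin p → Type*}
    (Λ : ∀ i, Set (I i × J i × K i)) :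
    Set ((Σ i, I i × J i) × (Σ i, J i × K i) × (Σ i, K i × I i)) :=
  {q | ∃ (i : Fin p) (x : I i) (y : J i) (z : K i), (x, y, z) ∈ Λ i ∧
    q = (⟨i, (x, y)⟩, ⟨i, (y, z)⟩, ⟨i, (z, x)⟩)}

lemma sum_mul_sum_mul_sum {F : Type*} [CommSemiring F] {α β γ : Type*} [Fintype α] [Fintype β]
    [Fintype γ] (f : α → F) (g : β → F) (h : γ → F) :
    (∑ x, f x) * (∑ y, g y) * (∑ z, h z) = ∑ x, ∑ y, ∑ z, f x * g y * h z := by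
  rw [Finset.sum_mul_sum]
  simp only [Finset.sum_mul]
  simp only [Finset.mul_sum]

lemma sum_sum_sum_comm {F : Type*} [AddCommMonoid F] {ι α β γ : Type*} [Fintype ι] [Fintype α]
    [Fintype β] [Fintype γ] (f : α → β → γ → ι → F) :
    ∑ x, ∑ y, ∑ z, ∑ m, f x y z m = ∑ m, ∑ x, ∑ y, ∑ z, f x y z m := by
  symm
  rw [Finset.sum_comm]
  refine Finset.sum_congr rfl fun x _ => ?_
  rw [Finset.sum_comm]
  refine Finset.sum_congr rfl fun y _ => ?_
  rw [Finset.sum_comm]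

/-! ### Rank decompositions indexed by a finite type -/

/-- `t` is a sum of rank-one tensors indexed by `ι`. -/
def HasDecomp {F : Type*} [Field F] {I J K : Type*} (ι : Type*) [Fintype ι]
    (t : I × J × K → F) : Prop :=
  ∃ (a : ι → I → F) (b : ι → J → F) (c : ι → K → F),
    ∀ x y z, t (x, y, z) = ∑ m, a m x * b m y * c m z

/-- The direct sum of copies of `t` indexed by `μ`. -/
def copies {F : Type*} [Field F] {I J K : Type*} (μ : Type*) [DecidableEq μ]
    (t : I × J × K → F) : (μ × I) × (μ × J) × (μ × K) → F :=
  fun q => if q.1.1 = q.2.1.1 ∧ q.2.1.1 = q.2.2.1 then t (q.1.2, q.2.1.2, q.2.2.2) else 0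

/-- The Kronecker power of `t` indexed by `δ`. -/
def kronPow {F : Type*} [Field F] {I J K : Type*} (δ : Type*) [Fintype δ]
    (t : I × J × K → F) : (δ → I) × (δ → J) × (δ → K) → F :=
  fun q => ∏ d, t (q.1 d, q.2.1 d, q.2.2 d)

section Decompositions

variable {F : Type*} [Field F] {I J K I' J' K' : Type*} {ι κ : Type*} [Fintype ι] [Fintype κ]

lemma HasDecomp.comp {t : I × J × K → F} (h : HasDecomp ι t) (f : I' → I) (g : J' → J)
    (e : K' → K) :
    HasDecomp ι (fun q : I' × J' × K' => t (f q.1, g q.2.1, e q.2.2)) := by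
  obtain ⟨a, b, c, h⟩ := h
  exact ⟨fun m x => a m (f x), fun m x => b m (g x), fun m x => c m (e x),
    fun x y z => h _ _ _⟩

lemma HasDecomp.of_card_le {t : I × J × K → F} (h : HasDecomp ι t)
    (hc : Fintype.card ι ≤ Fintype.card κ) : HasDecomp κ t := by
  classical
  obtain ⟨a, b, c, h⟩ := h
  obtain ⟨φ⟩ := Function.Embedding.nonempty_of_card_le hc
  refine ⟨fun m x => ∑ l, if φ l = m then a l x else 0,
    fun m x => ∑ l, if φ l = m then b l x else 0,
    fun m x => ∑ l, if φ l = m then c l x else 0, fun x y z => ?_⟩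
  rw [h, ← Finset.sum_subset (Finset.subset_univ (Finset.univ.map φ))]
  · rw [Finset.sum_map]
    refine Finset.sum_congr rfl fun l _ => ?_
    simp [φ.injective.eq_iff]
  · intro m _ hm
    have : ∀ l, φ l ≠ m := by simpa using hm
    simp [this]

lemma HasDecomp.tensorRank_le {t : I × J × K → F} (h : HasDecomp ι t) :
    TensorRank F t ≤ Fintype.card ι := by
  obtain ⟨a, b, c, h⟩ := h.of_card_le (κ := Fin (Fintype.card ι)) (by simp)
  exact Nat.sInf_le ⟨a, b, c, fun q => h _ _ _⟩

lemma hasDecomp_tensorRank [Finite I] [Finite J] [Finite K] (t : I × J × K → F) :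
    HasDecomp (Fin (TensorRank F t)) t := by
  classical
  cases nonempty_fintype I
  cases nonempty_fintype J
  cases nonempty_fintype K
  have key : HasDecomp (I × J × K) t := by
    refine ⟨fun m x => if m.1 = x then t m else 0, fun m y => if m.2.1 = y then 1 else 0,
      fun m z => if m.2.2 = z then 1 else 0, fun x y z => ?_⟩
    rw [Finset.sum_eq_single (x, y, z)]
    · simp
    · rintro ⟨x', y', z'⟩ - hne
      by_cases h1 : x' = x <;> by_cases h2 : y' = y <;> by_cases h3 : z' = z <;> simp_all
    · simp
  obtain ⟨a, b, c, h⟩ := key.of_card_le (κ := Fin (Fintype.card (I × J × K))) (by simp)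
  have hmem := Nat.sInf_mem (s := {L : ℕ | ∃ (a : Fin L → I → F) (b : Fin L → J → F)
    (c : Fin L → K → F), ∀ q : I × J × K, t q = ∑ m, a m q.1 * b m q.2.1 * c m q.2.2})
    ⟨_, a, b, c, fun q => h _ _ _⟩
  obtain ⟨a, b, c, h⟩ := hmem
  exact ⟨a, b, c, fun x y z => h (x, y, z)⟩

lemma exists_hasDecomp_supportRank [Finite I] [Finite J] [Finite K] (Φ : Set (I × J × K)) :
    ∃ t : I × J × K → F, {q | t q ≠ 0} = Φ ∧ HasDecomp (Fin (SupportRank F Φ)) t := by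
  classical
  have hne : (TensorRank F '' {t : I × J × K → F | {q | t q ≠ 0} = Φ}).Nonempty :=
    Set.Nonempty.image _ ⟨fun q => if q ∈ Φ then 1 else 0, by simp⟩
  obtain ⟨t, ht, hr⟩ := Nat.sInf_mem hne
  refine ⟨t, ht, ?_⟩
  change HasDecomp (Fin (sInf _)) t
  rw [← hr]
  exact hasDecomp_tensorRank t

lemma HasDecomp.supportRank_le {t : I × J × K → F} (h : HasDecomp ι t) {Φ : Set (I × J × K)}
    (ht : {q | t q ≠ 0} = Φ) : SupportRank F Φ ≤ Fintype.card ι := by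
  refine (Nat.sInf_le ?_).trans h.tensorRank_le
  exact ⟨t, ht, rfl⟩

/-- Applying a linear map to each leg of a tensor preserves decompositions. -/
lemma HasDecomp.restrict [Fintype I] [Fintype J] [Fintype K] {t : I × J × K → F}
    (h : HasDecomp ι t) (A : I' → I → F) (B : J' → J → F) (C : K' → K → F) :
    HasDecomp ι (fun q : I' × J' × K' =>
      ∑ x, ∑ y, ∑ z, A q.1 x * B q.2.1 y * C q.2.2 z * t (x, y, z)) := by
  obtain ⟨a, b, c, h⟩ := h
  refine ⟨fun m x' => ∑ x, A x' x * a m x, fun m y' => ∑ y, B y' y * b m y,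
    fun m z' => ∑ z, C z' z * c m z, fun x' y' z' => ?_⟩
  simp only [h, sum_mul_sum_mul_sum]
  simp only [Finset.mul_sum]
  rw [sum_sum_sum_comm]
  refine Finset.sum_congr rfl fun m _ => Finset.sum_congr rfl fun x _ =>
    Finset.sum_congr rfl fun y _ => Finset.sum_congr rfl fun z _ => ?_
  ring

lemma HasDecomp.pow {t : I × J × K → F} (h : HasDecomp ι t) (δ : Type*) [Fintype δ]
    [DecidableEq δ] : HasDecomp (δ → ι) (kronPow δ t) := by
  classical
  obtain ⟨a, b, c, h⟩ := h
  refine ⟨fun m x => ∏ d, a (m d) (x d), fun m x => ∏ d, b (m d) (x d),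
    fun m x => ∏ d, c (m d) (x d), fun x y z => ?_⟩
  simp only [kronPow, h, Finset.prod_univ_sum, Fintype.piFinset_univ,
    Finset.prod_mul_distrib]

/-- Recursion: a decomposition of `μ` copies of `t` into `γ × μ` terms gives a decomposition of
`μ` copies of the `k`-th Kronecker power of `t` into `γ ^ k × μ` terms. -/
lemma HasDecomp.copies_kronPow {t : I × J × K → F} {γ μ : Type*} [Fintype γ] [Fintype μ]
    [DecidableEq μ] (h : HasDecomp (γ × μ) (copies μ t)) (k : ℕ) :
    HasDecomp ((Fin k → γ) × μ) (copies μ (kronPow (Fin k) t)) := by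
  classical
  induction k with
  | zero =>
    refine ⟨fun m x => if m.2 = x.1 then 1 else 0, fun m x => if m.2 = x.1 then 1 else 0,
      fun m x => if m.2 = x.1 then 1 else 0, fun x y z => ?_⟩
    rw [Fintype.sum_prod_type]
    simp only [copies, kronPow, Finset.univ_eq_empty, Finset.prod_empty]
    by_cases h1 : x.1 = y.1 <;> by_cases h2 : y.1 = z.1 <;> simp_all <;> grind
  | succ k ih =>
    obtain ⟨a, b, c, h⟩ := h
    obtain ⟨a', b', c', h'⟩ := ih
    have key : HasDecomp (γ × (Fin k → γ) × μ) (copies μ (kronPow (Fin (k + 1)) t)) := by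
      refine ⟨fun m x => ∑ w, a (m.1, w) (x.1, x.2 0) * a' m.2 (w, Fin.tail x.2),
        fun m x => ∑ w, b (m.1, w) (x.1, x.2 0) * b' m.2 (w, Fin.tail x.2),
        fun m x => ∑ w, c (m.1, w) (x.1, x.2 0) * c' m.2 (w, Fin.tail x.2), fun x y z => ?_⟩
      have e1 : copies μ (kronPow (Fin (k + 1)) t) (x, y, z) =
          copies μ t ((x.1, x.2 0), (y.1, y.2 0), (z.1, z.2 0)) *
            kronPow (Fin k) t (Fin.tail x.2, Fin.tail y.2, Fin.tail z.2) := by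
        simp only [copies, kronPow, Fin.prod_univ_succ, Fin.tail, ite_mul, zero_mul]
      have e2 : ∀ w w' w'', ∑ m, a' m (w, Fin.tail x.2) * b' m (w', Fin.tail y.2) *
          c' m (w'', Fin.tail z.2) = if w = w' ∧ w' = w'' then
            kronPow (Fin k) t (Fin.tail x.2, Fin.tail y.2, Fin.tail z.2) else 0 :=
        fun w w' w'' => (h' _ _ _).symm
      rw [e1, h, Fintype.sum_prod_type, Fintype.sum_prod_type, Finset.sum_mul]
      refine Finset.sum_congr rfl fun α _ => ?_
      simp only [sum_mul_sum_mul_sum]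
      rw [← sum_sum_sum_comm, Finset.sum_mul]
      refine Finset.sum_congr rfl fun w _ => ?_
      have e3 : ∀ w' w'', ∑ m, a (α, w) (x.1, x.2 0) * a' m (w, Fin.tail x.2) *
            (b (α, w') (y.1, y.2 0) * b' m (w', Fin.tail y.2)) *
            (c (α, w'') (z.1, z.2 0) * c' m (w'', Fin.tail z.2)) =
          a (α, w) (x.1, x.2 0) * b (α, w') (y.1, y.2 0) * c (α, w'') (z.1, z.2 0) *
            if w = w' ∧ w' = w'' then
              kronPow (Fin k) t (Fin.tail x.2, Fin.tail y.2, Fin.tail z.2) else 0 := by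
        intro w' w''
        rw [← e2, Finset.mul_sum]
        exact Finset.sum_congr rfl fun m _ => by ring
      simp only [e3]
      rw [Finset.sum_eq_single w, Finset.sum_eq_single w]
      · simp
      · intro w'' _ hw
        simp [hw.symm]
      · simp
      · intro w' _ hw
        simp [hw.symm]
      · simp
    exact key.of_card_le (by simp [pow_succ]; apply le_of_eq; ring)

end Decompositions

section Copies

variable {F : Type*} [Field F] {I J K : Type*} {ι : Type*} [Fintype ι]

/-- A direct sum of copies of a nonzero tensor has rank at least the number of copies. -/
lemma HasDecomp.card_le_of_copies {t : I × J × K → F} {μ : Type*} [Fintype μ] [DecidableEq μ]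
    (h : HasDecomp ι (copies μ t)) {q : I × J × K} (hq : t q ≠ 0) :
    Fintype.card μ ≤ Fintype.card ι := by
  classical
  obtain ⟨a, b, c, h⟩ := h
  obtain ⟨x, y, z⟩ := q
  let A : Matrix μ ι F := Matrix.of fun w m => a m (w, x)
  let B : Matrix ι μ F := Matrix.of fun m w => b m (w, y) * ∑ w', c m (w', z)
  have hAB : A * B = t (x, y, z) • (1 : Matrix μ μ F) := by
    ext w w'
    have e : ∀ w'', ∑ m, a m (w, x) * b m (w', y) * c m (w'', z) =
      if w = w' ∧ w' = w'' then t (x, y, z) else 0 := fun w'' => (h _ _ _).symm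
    calc (A * B) w w' = ∑ w'', ∑ m, a m (w, x) * b m (w', y) * c m (w'', z) := by
          rw [Finset.sum_comm, Matrix.mul_apply]
          refine Finset.sum_congr rfl fun m _ => ?_
          simp only [A, B, Matrix.of_apply, Finset.mul_sum, mul_assoc]
      _ = _ := by
          simp only [e]
          by_cases hw : w = w' <;> simp [hw]
  have hr : (A * B).rank = Fintype.card μ := by
    rw [hAB]
    refine Matrix.rank_of_isUnit _ ?_
    rw [Matrix.isUnit_iff_isUnit_det, Matrix.det_smul]
    simp [hq]
  rw [← hr]
  exact (Matrix.rank_mul_le_left A B).trans (Matrix.rank_le_card_width A)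

variable {S : Type*} {δ : Type*} [Fintype δ]

/-- The restriction of a Kronecker power to the indices with prescribed labels `w₀`. -/
def typeBlock (δ : Type*) [Fintype δ] (t : I × J × K → F) (lI : I → S) (lJ : J → S) (lK : K → S)
    (w₀ : δ → S) :
    {ξ : δ → I // lI ∘ ξ = w₀} × {ξ : δ → J // lJ ∘ ξ = w₀} × {ξ : δ → K // lK ∘ ξ = w₀} → F :=
  fun q => kronPow δ t (q.1.1, q.2.1.1, q.2.2.1)

/-- The label sequences obtained from `w₀` by permuting positions. -/
abbrev TypeClass (w₀ : δ → S) : Type _ := {w : δ → S // ∃ π : Equiv.Perm δ, w = w₀ ∘ π}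

lemma HasDecomp.copies_typeBlock [DecidableEq δ] [DecidableEq S] {t : I × J × K → F}
    (h : HasDecomp ι t) (lI : I → S) (lJ : J → S) (lK : K → S)
    (hl : ∀ x y z, t (x, y, z) ≠ 0 → lI x = lJ y ∧ lJ y = lK z) (w₀ : δ → S) :
    HasDecomp (δ → ι) (copies (TypeClass w₀) (typeBlock δ t lI lJ lK w₀)) := by
  choose π hπ using fun w : TypeClass w₀ => w.2
  have key := (h.pow δ).comp
    (fun x : TypeClass w₀ × {ξ : δ → I // lI ∘ ξ = w₀} => x.2.1 ∘ π x.1)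
    (fun x : TypeClass w₀ × {ξ : δ → J // lJ ∘ ξ = w₀} => x.2.1 ∘ π x.1)
    (fun x : TypeClass w₀ × {ξ : δ → K // lK ∘ ξ = w₀} => x.2.1 ∘ π x.1)
  convert key using 1
  funext ⟨⟨w, ξ, hξ⟩, ⟨w', η, hη⟩, ⟨w'', ζ, hζ⟩⟩
  simp only [copies, typeBlock, kronPow, Function.comp]
  split_ifs with hw
  · obtain ⟨rfl, rfl⟩ := hw
    exact (Equiv.prod_comp (π w) fun d => t (ξ d, η d, ζ d)).symm
  · symm
    by_contra hne
    rw [← ne_eq, Finset.prod_ne_zero_iff] at hne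
    refine hw ⟨Subtype.ext ?_, Subtype.ext ?_⟩
    · rw [hπ w, hπ w', ← hξ]
      nth_rewrite 2 [hξ]
      rw [← hη]
      funext d
      exact (hl _ _ _ (hne d (Finset.mem_univ d))).1
    · rw [hπ w', hπ w'', ← hη]
      nth_rewrite 2 [hη]
      rw [← hζ]
      funext d
      exact (hl _ _ _ (hne d (Finset.mem_univ d))).2

lemma factorial_le_card_typeClass_mul [Fintype S] [DecidableEq S] [DecidableEq δ] (w₀ : δ → S)
    [Fintype (TypeClass w₀)] :
    (Fintype.card δ).factorial ≤
      Fintype.card (TypeClass w₀) * ∏ σ, (Fintype.card {d // w₀ d = σ}).factorial := by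
  classical
  rw [← Fintype.card_perm, ← DomMulAct.stabilizer_card w₀]
  let f : Equiv.Perm δ → TypeClass w₀ := fun π => ⟨w₀ ∘ π, π, rfl⟩
  rw [mul_comm, ← Finset.card_univ, ← Finset.card_univ (α := TypeClass w₀)]
  refine Finset.card_le_mul_card_image_of_maps_to (f := f) (fun _ _ => Finset.mem_univ _) _ ?_
  rintro ⟨_, π, rfl⟩ -
  rw [← Fintype.card_coe]
  refine Fintype.card_le_of_injective (fun τ => ⟨τ.1 * π⁻¹, ?_⟩) ?_
  · have := τ.2
    simp only [Finset.mem_filter, Finset.mem_univ, true_and, f, Subtype.mk.injEq] at this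
    funext d
    simpa using congrFun this (π⁻¹ d)
  · intro τ τ' hτ
    exact Subtype.ext (mul_right_cancel (congrArg Subtype.val hτ))

end Copies

section Projection

variable {F : Type*} [Field F] [Infinite F] {I J K : Type*} [Fintype I] [Fintype J] [Fintype K]
  {ι : Type*} [Fintype ι]

/-- A partial matrix multiplication tensor whose pattern surjects onto a box degenerates, by a
generic rescaling of its legs, to a tensor with full matrix multiplication support. -/
lemma supportRank_mmSupport_le {Λ : Set (I × J × K)} {U : (I × J) × (J × K) × (K × I) → F}
    (hU : HasDecomp ι U)
    (hsupp : ∀ x y y' z z' x', U ((x, y), (y', z), (z', x')) ≠ 0 ↔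
      y = y' ∧ z = z' ∧ x = x' ∧ (x, y, z) ∈ Λ)
    {α β γ : Type*} [Fintype α] [Fintype β] [Fintype γ] (f : I → α) (g : J → β) (h : K → γ)
    (hsurj : ∀ a b c, ∃ x y z, (x, y, z) ∈ Λ ∧ f x = a ∧ g y = b ∧ h z = c)
    {l m n : ℕ} (hl : l ≤ Fintype.card α) (hm : m ≤ Fintype.card β) (hn : n ≤ Fintype.card γ) :
    SupportRank F (MMSupport l m n) ≤ Fintype.card ι := by
  classical
  obtain ⟨jα⟩ := Function.Embedding.nonempty_of_card_le (α := Fin l) (by simpa using hl)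
  obtain ⟨jβ⟩ := Function.Embedding.nonempty_of_card_le (α := Fin m) (by simpa using hm)
  obtain ⟨jγ⟩ := Function.Embedding.nonempty_of_card_le (α := Fin n) (by simpa using hn)
  let e₁ : I × J → ℕ := fun v => Fintype.equivFin (I × J) v
  let e₂ : J × K → ℕ := fun v => Fintype.card (I × J) * Fintype.equivFin K v.2
  have he : ∀ x y z x' y' z', e₁ (x, y) + e₂ (y, z) = e₁ (x', y') + e₂ (y', z') →
      x = x' ∧ y = y' ∧ z = z' := by
    intro x y z x' y' z' hh
    simp only [e₁, e₂] at hh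
    have l1 := (Fintype.equivFin (I × J) (x, y)).2
    have l2 := (Fintype.equivFin (I × J) (x', y')).2
    have h1 := congrArg (· % Fintype.card (I × J)) hh
    have h2 := congrArg (· / Fintype.card (I × J)) hh
    have hpos : 0 < Fintype.card (I × J) := by omega
    simp only [Nat.add_mul_mod_self_left, Nat.mod_eq_of_lt l1, Nat.mod_eq_of_lt l2] at h1
    simp only [Nat.add_mul_div_left _ _ hpos, Nat.div_eq_of_lt l1, Nat.div_eq_of_lt l2,
      zero_add] at h2
    have h3 := (Fintype.equivFin (I × J)).injective (Fin.ext h1)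
    have h4 := (Fintype.equivFin K).injective (Fin.ext h2)
    simp_all
  let cond : (α × β × γ) → I × J → J × K → K × I → Prop := fun v p q r =>
    f p.1 = v.1 ∧ g p.2 = v.2.1 ∧ g q.1 = v.2.1 ∧ h q.2 = v.2.2 ∧ h r.1 = v.2.2 ∧ f r.2 = v.1
  let P : α × β × γ → Polynomial F := fun v => ∑ p, ∑ q, ∑ r,
    if cond v p q r then Polynomial.C (U (p, q, r)) * Polynomial.X ^ (e₁ p + e₂ q) else 0
  have hP : ∀ v, P v ≠ 0 := by
    rintro ⟨a, b, c⟩ h0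
    obtain ⟨x, y, z, hΛ, rfl, rfl, rfl⟩ := hsurj a b c
    have hc := congrArg (fun s => Polynomial.coeff s (e₁ (x, y) + e₂ (y, z))) h0
    have hzero : ∀ p q r, (p, q, r) ≠ ((x, y), (y, z), (z, x)) →
        (if cond (f x, g y, h z) p q r then
          Polynomial.C (U (p, q, r)) * Polynomial.X ^ (e₁ p + e₂ q) else 0).coeff
          (e₁ (x, y) + e₂ (y, z)) = 0 := by
      rintro ⟨x₁, y₁⟩ ⟨y₂, z₁⟩ ⟨z₂, x₂⟩ hne
      split_ifs
      · rw [Polynomial.coeff_C_mul_X_pow]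
        split_ifs with hE
        · by_contra hU0
          obtain ⟨rfl, rfl, rfl, -⟩ := (hsupp _ _ _ _ _ _).1 hU0
          obtain ⟨rfl, rfl, rfl⟩ := he _ _ _ _ _ _ hE
          exact hne rfl
        · rfl
      · simp
    simp only [P, Polynomial.finsetSum_coeff, Polynomial.coeff_zero] at hc
    rw [Finset.sum_eq_single (x, y), Finset.sum_eq_single (y, z),
      Finset.sum_eq_single (z, x)] at hc
    · rw [if_pos (by simp [cond]), Polynomial.coeff_C_mul_X_pow, if_pos rfl] at hc
      exact (hsupp x y y z z x).2 ⟨rfl, rfl, rfl, hΛ⟩ hc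
    · exact fun r _ hr => hzero _ _ _ (by simpa using hr)
    · simp
    · exact fun q _ hq => Finset.sum_eq_zero fun r _ => hzero _ _ _ (by simp [hq])
    · simp
    · exact fun p _ hp => Finset.sum_eq_zero fun q _ => Finset.sum_eq_zero fun r _ =>
        hzero _ _ _ (by simp [hp])
    · simp
  obtain ⟨θ, hθ⟩ : ∃ θ : F, (∏ v, P v).eval θ ≠ 0 := by
    by_contra! hall
    exact Finset.prod_ne_zero_iff.2 (fun v _ => hP v)
      (Polynomial.funext (p := ∏ v, P v) (q := 0) (by simpa using hall))
  rw [Polynomial.eval_prod, Finset.prod_ne_zero_iff] at hθ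
  have key := (hU.restrict
    (fun (v : α × β) (p : I × J) => if f p.1 = v.1 ∧ g p.2 = v.2 then θ ^ e₁ p else 0)
    (fun (v : β × γ) (p : J × K) => if g p.1 = v.1 ∧ h p.2 = v.2 then θ ^ e₂ p else 0)
    (fun (v : γ × α) (p : K × I) => if h p.1 = v.1 ∧ f p.2 = v.2 then 1 else 0)).comp
    (fun v : Fin l × Fin m => (jα v.1, jβ v.2)) (fun v : Fin m × Fin n => (jβ v.1, jγ v.2))
    (fun v : Fin n × Fin l => (jγ v.1, jα v.2))
  refine key.supportRank_le (Set.ext ?_)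
  rintro ⟨⟨a, b⟩, ⟨b', c⟩, ⟨c', a'⟩⟩
  simp only [Set.mem_ofPred_eq, MMSupport, Prod.mk.injEq]
  constructor
  · intro hne
    obtain ⟨⟨x, y⟩, -, hne⟩ := Finset.exists_ne_zero_of_sum_ne_zero hne
    obtain ⟨⟨y', z⟩, -, hne⟩ := Finset.exists_ne_zero_of_sum_ne_zero hne
    obtain ⟨⟨z', x'⟩, -, hne⟩ := Finset.exists_ne_zero_of_sum_ne_zero hne
    obtain ⟨rfl, rfl, rfl, -⟩ := (hsupp _ _ _ _ _ _).1 (right_ne_zero_of_mul hne)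
    have h1 := left_ne_zero_of_mul hne
    have h2 := right_ne_zero_of_mul h1
    have h3 := left_ne_zero_of_mul h1
    have h4 := right_ne_zero_of_mul h3
    have h5 := left_ne_zero_of_mul h3
    simp only [ne_eq, ite_eq_right_iff, not_forall] at h2 h4 h5
    obtain ⟨⟨q1, q2⟩, -⟩ := h2
    obtain ⟨⟨q3, q4⟩, -⟩ := h4
    obtain ⟨⟨q5, q6⟩, -⟩ := h5
    refine ⟨a, b, c, ⟨rfl, rfl⟩, ⟨jβ.injective ?_, rfl⟩, jγ.injective ?_, jα.injective ?_⟩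
    · rw [← q3, q6]
    · rw [← q1, q4]
    · rw [← q2, q5]
  · rintro ⟨a, b, c, ⟨rfl, rfl⟩, ⟨rfl, rfl⟩, rfl, rfl⟩
    convert hθ (jα a', jβ b', jγ c') (Finset.mem_univ _) using 1
    simp only [P, Polynomial.eval_finsetSum]
    refine Finset.sum_congr rfl fun p _ => Finset.sum_congr rfl fun q _ =>
      Finset.sum_congr rfl fun r _ => ?_
    by_cases h1 : f p.1 = jα a' ∧ g p.2 = jβ b' <;>
    by_cases h2 : g q.1 = jβ b' ∧ h q.2 = jγ c' <;>
    by_cases h3 : h r.1 = jγ c' ∧ f r.2 = jα a'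
    · have hcond : cond (jα a', jβ b', jγ c') p q r := by simp only [cond]; tauto
      simp only [h1, h2, h3, hcond, and_self, if_true, Polynomial.eval_mul, Polynomial.eval_C,
        Polynomial.eval_pow, Polynomial.eval_X, pow_add]
      ring
    all_goals
      have hcond : ¬ cond (jα a', jβ b', jγ c') p q r := by simp only [cond]; tauto
      simp [h1, h2, h3, hcond]

end Projection

lemma Achievable.exists_surj {I J K : Type*} {Λ : Set (I × J × K)} {r : ℝ × ℝ × ℝ}
    (h : Achievable Λ r) (n : ℕ) :
    ∃ (f : (Fin n → I) → Fin ⌊(2 : ℝ) ^ (r.1 * n)⌋₊)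
      (g : (Fin n → J) → Fin ⌊(2 : ℝ) ^ (r.2.1 * n)⌋₊)
      (e : (Fin n → K) → Fin ⌊(2 : ℝ) ^ (r.2.2 * n)⌋₊),
      ∀ a b c, ∃ x y z, (x, y, z) ∈ PowSupport Λ n ∧ f x = a ∧ g y = b ∧ e z = c := by
  rcases Nat.eq_zero_or_pos n with rfl | hn
  · have h1 : ∀ s : ℝ, ⌊(2 : ℝ) ^ (s * (0 : ℕ))⌋₊ = 1 := by simp
    refine ⟨fun _ => ⟨0, by simp⟩, fun _ => ⟨0, by simp⟩, fun _ => ⟨0, by simp⟩,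
      fun a b c => ⟨Fin.elim0, Fin.elim0, Fin.elim0, fun s => s.elim0, ?_, ?_, ?_⟩⟩
    · have := a.2; have := h1 r.1; apply Fin.ext; simp only; omega
    · have := b.2; have := h1 r.2.1; apply Fin.ext; simp only; omega
    · have := c.2; have := h1 r.2.2; apply Fin.ext; simp only; omega
  · obtain ⟨f, g, e, hs⟩ := h.2.2.2 n hn
    refine ⟨f, g, e, fun a b c => ?_⟩
    have : (a, b, c) ∈ (fun q : (Fin n → I) × (Fin n → J) × (Fin n → K) =>
        (f q.1, g q.2.1, e q.2.2)) '' PowSupport Λ n := hs ▸ Set.mem_univ _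
    obtain ⟨⟨x, y, z⟩, hq, heq⟩ := this
    simp only [Prod.mk.injEq] at heq
    exact ⟨x, y, z, hq, heq⟩

section Family

variable {p : ℕ} {I J K : Fin p → Type*}

/-- Reads off, along an enumeration of the positions with label `i`, the coordinates of `x`. -/
def labelCoords {D : Type*} {X : Fin p → Type*} {ℓ : D → Fin p} {m : Fin p → ℕ}
    (e : ∀ i, Fin (m i) ≃ {d // ℓ d = i}) (x : ∀ d, X (ℓ d)) (i : Fin p) : Fin (m i) → X i :=
  fun s => (e i s).2 ▸ x (e i s).1

lemma labelCoords_glue {D : Type*} {X : Fin p → Type*} {ℓ : D → Fin p} {m : Fin p → ℕ}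
    (e : ∀ i, Fin (m i) ≃ {d // ℓ d = i}) (x : ∀ i, Fin (m i) → X i) (i : Fin p) :
    labelCoords e (fun d => x (ℓ d) ((e (ℓ d)).symm ⟨d, rfl⟩)) i = x i := by
  funext s
  obtain ⟨d, rfl⟩ := (e i).symm.surjective s
  obtain ⟨d, rfl⟩ := d
  have key : ∀ w : {d' // ℓ d' = ℓ d}, w = ⟨d, rfl⟩ →
      (w.2 ▸ x (ℓ w.1) ((e (ℓ w.1)).symm ⟨w.1, rfl⟩) : X (ℓ d)) =
        x (ℓ d) ((e (ℓ d)).symm ⟨d, rfl⟩) := by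
    rintro _ rfl
    rfl
  exact key _ (Equiv.apply_symm_apply _ _)

/-- The labelled product of achieving maps surjects onto a product of boxes. -/
lemma exists_surj_of_achievable {Λ : ∀ i, Set (I i × J i × K i)} {u : Fin p → ℝ × ℝ × ℝ}
    (hu : ∀ i, Achievable (Λ i) (u i)) {D : Type*} [Fintype D] (ℓ : D → Fin p) (m : Fin p → ℕ)
    (hm : ∀ i, Fintype.card {d // ℓ d = i} = m i) :
    ∃ (f : (∀ d, I (ℓ d)) → ∀ i, Fin ⌊(2 : ℝ) ^ ((u i).1 * m i)⌋₊)
      (g : (∀ d, J (ℓ d)) → ∀ i, Fin ⌊(2 : ℝ) ^ ((u i).2.1 * m i)⌋₊)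
      (e : (∀ d, K (ℓ d)) → ∀ i, Fin ⌊(2 : ℝ) ^ ((u i).2.2 * m i)⌋₊),
      ∀ a b c, ∃ x y z, (∀ d, (x d, y d, z d) ∈ Λ (ℓ d)) ∧ f x = a ∧ g y = b ∧ e z = c := by
  choose f g e hs using fun i => (hu i).exists_surj (m i)
  let E : ∀ i, Fin (m i) ≃ {d // ℓ d = i} := fun i => (Fintype.equivFinOfCardEq (hm i)).symm
  refine ⟨fun x i => f i (labelCoords E x i), fun x i => g i (labelCoords E x i),
    fun x i => e i (labelCoords E x i), fun a b c => ?_⟩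
  choose x y z hmem hx hy hz using fun i => hs i (a i) (b i) (c i)
  refine ⟨fun d => x (ℓ d) ((E (ℓ d)).symm ⟨d, rfl⟩), fun d => y (ℓ d) ((E (ℓ d)).symm ⟨d, rfl⟩),
    fun d => z (ℓ d) ((E (ℓ d)).symm ⟨d, rfl⟩), fun d => hmem (ℓ d) _, ?_, ?_, ?_⟩
  · funext i
    exact (congrArg (f i) (labelCoords_glue E x i)).trans (hx i)
  · funext i
    exact (congrArg (g i) (labelCoords_glue E y i)).trans (hy i)
  · funext i
    exact (congrArg (e i) (labelCoords_glue E z i)).trans (hz i)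

lemma mem_famPMMSumSupport_iff {Λ : ∀ i, Set (I i × J i × K i)} {i : Fin p} {x x' : I i}
    {y y' : J i} {z z' : K i} :
    ((⟨i, (x, y)⟩, ⟨i, (y', z)⟩, ⟨i, (z', x')⟩) :
      (Σ i, I i × J i) × (Σ i, J i × K i) × (Σ i, K i × I i)) ∈ FamPMMSumSupport Λ ↔
      y = y' ∧ z = z' ∧ x = x' ∧ (x, y, z) ∈ Λ i := by
  constructor
  · rintro ⟨i₁, x₁, y₁, z₁, hmem, heq⟩
    simp only [Prod.mk.injEq, Sigma.mk.injEq] at heq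
    obtain ⟨⟨rfl, h1⟩, ⟨-, h2⟩, -, h3⟩ := heq
    simp only [heq_eq_eq, Prod.mk.injEq] at h1 h2 h3
    obtain ⟨rfl, rfl⟩ := h1
    obtain ⟨rfl, rfl⟩ := h2
    obtain ⟨rfl, rfl⟩ := h3
    exact ⟨rfl, rfl, rfl, hmem⟩
  · rintro ⟨rfl, rfl, rfl, hmem⟩
    exact ⟨i, x, y, z, hmem, rfl⟩

lemma label_eq_of_mem_famPMMSumSupport {Λ : ∀ i, Set (I i × J i × K i)}
    {q : (Σ i, I i × J i) × (Σ i, J i × K i) × (Σ i, K i × I i)}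
    (hq : q ∈ FamPMMSumSupport Λ) : q.1.1 = q.2.1.1 ∧ q.2.1.1 = q.2.2.1 := by
  obtain ⟨i, x, y, z, -, rfl⟩ := hq
  exact ⟨rfl, rfl⟩

/-- Number of occurrences of the letter `i` in a word list with `n σ` copies of each word `σ`. -/
def letterCount {N : ℕ} (n : (Fin N → Fin p) → ℕ) (i : Fin p) : ℕ :=
  ∑ σ, n σ * Fintype.card {s // σ s = i}

/-- Finite form of the asymptotic sum inequality for a fixed type `n` on words of length `N`. -/
lemma exists_supportRank_mmSupport_le (F : Type*) [Field F] [Infinite F]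
    [∀ i, Fintype (I i)] [∀ i, Fintype (J i)] [∀ i, Fintype (K i)]
    {Λ : ∀ i, Set (I i × J i × K i)} (hΛ : ∀ i, (Λ i).Nonempty) (N : ℕ)
    {u : Fin p → ℝ × ℝ × ℝ} (hu : ∀ i, Achievable (Λ i) (u i)) (n : (Fin N → Fin p) → ℕ) :
    ∃ M : ℕ, 0 < M ∧ (∑ σ, n σ).factorial ≤ M * ∏ σ, (n σ).factorial ∧
      M ≤ SupportRank F (PowSupport (FamPMMSumSupport Λ) N) ^ ∑ σ, n σ ∧
      ∀ k A B C : ℕ,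
        A ≤ ∏ i, ⌊(2 : ℝ) ^ ((u i).1 * (k * letterCount n i : ℕ))⌋₊ →
        B ≤ ∏ i, ⌊(2 : ℝ) ^ ((u i).2.1 * (k * letterCount n i : ℕ))⌋₊ →
        C ≤ ∏ i, ⌊(2 : ℝ) ^ ((u i).2.2 * (k * letterCount n i : ℕ))⌋₊ →
        SupportRank F (MMSupport A B C) ≤
          (SupportRank F (PowSupport (FamPMMSumSupport Λ) N) ^ (∑ σ, n σ) / M + 1) ^ k * M := by
  classical
  obtain ⟨t, ht, hdec⟩ := exists_hasDecomp_supportRank (F := F)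
    (PowSupport (FamPMMSumSupport Λ) N)
  set r := SupportRank F (PowSupport (FamPMMSumSupport Λ) N) with hr
  have ht' : ∀ x y z, t (x, y, z) ≠ 0 ↔ ∀ s, (x s, y s, z s) ∈ FamPMMSumSupport Λ :=
    fun x y z => Set.ext_iff.1 ht (x, y, z)
  let δ := Σ σ : Fin N → Fin p, Fin (n σ)
  let w₀ : δ → Fin N → Fin p := Sigma.fst
  have hδ : Fintype.card δ = ∑ σ, n σ := by simp [δ]
  have hfib : ∀ σ, Fintype.card {d : δ // w₀ d = σ} = n σ := fun σ => by
    rw [Fintype.card_congr (Equiv.sigmaSubtype σ)]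
    simp
  have hcop := hdec.copies_typeBlock (δ := δ) (fun x s => (x s).1) (fun x s => (x s).1)
    (fun x s => (x s).1) (fun x y z h =>
      ⟨funext fun s => (label_eq_of_mem_famPMMSumSupport ((ht' x y z).1 h s)).1,
       funext fun s => (label_eq_of_mem_famPMMSumSupport ((ht' x y z).1 h s)).2⟩) w₀
  have : Nonempty (TypeClass w₀) := ⟨⟨w₀, 1, rfl⟩⟩
  set T := typeBlock δ t (fun x s => (x s).1) (fun x s => (x s).1) (fun x s => (x s).1) w₀
    with hT
  have hcardι : Fintype.card (δ → Fin r) = r ^ ∑ σ, n σ := by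
    rw [Fintype.card_fun, hδ, Fintype.card_fin]
  let M := Fintype.card (TypeClass w₀)
  have hM : 0 < M := Fintype.card_pos
  refine ⟨M, hM, ?_, ?_, ?_⟩
  · have := factorial_le_card_typeClass_mul w₀
    simpa only [hδ, hfib] using this
  · choose q hq using hΛ
    have hT0 : T (⟨fun d s => ⟨w₀ d s, ((q _).1, (q _).2.1)⟩, rfl⟩,
        ⟨fun d s => ⟨w₀ d s, ((q _).2.1, (q _).2.2)⟩, rfl⟩,
        ⟨fun d s => ⟨w₀ d s, ((q _).2.2, (q _).1)⟩, rfl⟩) ≠ 0 := by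
      simp only [hT, typeBlock, kronPow, Finset.prod_ne_zero_iff]
      intro d _
      rw [ht']
      intro s
      exact mem_famPMMSumSupport_iff.2 ⟨rfl, rfl, rfl, hq _⟩
    rw [← hcardι]
    exact hcop.card_le_of_copies hT0
  · intro k A B C hA hB hC
    let ℓ : Fin k × δ × Fin N → Fin p := fun d => w₀ d.2.1 d.2.2
    have hℓ : ∀ i, Fintype.card {d // ℓ d = i} = k * letterCount n i := by
      intro i
      let e : {d // ℓ d = i} ≃ Fin k × Σ d : δ, {s // w₀ d s = i} :=
        { toFun := fun d => (d.1.1, ⟨d.1.2.1, d.1.2.2, d.2⟩)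
          invFun := fun d => ⟨(d.1, d.2.1, d.2.2.1), d.2.2.2⟩
          left_inv := fun _ => rfl
          right_inv := fun _ => rfl }
      rw [Fintype.card_congr e, Fintype.card_prod, Fintype.card_fin, Fintype.card_sigma,
        Fintype.sum_sigma]
      refine congrArg (k * ·) (Finset.sum_congr rfl fun σ _ => ?_)
      refine (Finset.sum_const (Fintype.card {s // σ s = i})).trans ?_
      rw [Finset.card_univ, Fintype.card_fin, smul_eq_mul]
    obtain ⟨f, g, e, hs⟩ := exists_surj_of_achievable hu ℓ (fun i => k * letterCount n i) hℓ
    have hle : r ^ (∑ σ, n σ) ≤ (r ^ (∑ σ, n σ) / M + 1) * M := by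
      rw [mul_comm]
      exact (Nat.lt_mul_div_succ _ hM).le
    have hγ : HasDecomp (Fin (r ^ (∑ σ, n σ) / M + 1) × TypeClass w₀) (copies _ T) :=
      hcop.of_card_le (by rw [hcardι, Fintype.card_prod, Fintype.card_fin]; exact hle)
    have hU := ((hγ.copies_kronPow k).comp
      (fun ξ => (Classical.arbitrary _, ξ)) (fun ξ => (Classical.arbitrary _, ξ))
      (fun ξ => (Classical.arbitrary _, ξ))).comp
      (fun v : (∀ d, I (ℓ d)) × (∀ d, J (ℓ d)) => fun j =>
        ⟨fun d s => ⟨w₀ d s, (v.1 (j, d, s), v.2 (j, d, s))⟩, rfl⟩)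
      (fun v : (∀ d, J (ℓ d)) × (∀ d, K (ℓ d)) => fun j =>
        ⟨fun d s => ⟨w₀ d s, (v.1 (j, d, s), v.2 (j, d, s))⟩, rfl⟩)
      (fun v : (∀ d, K (ℓ d)) × (∀ d, I (ℓ d)) => fun j =>
        ⟨fun d s => ⟨w₀ d s, (v.1 (j, d, s), v.2 (j, d, s))⟩, rfl⟩)
    have hfin := supportRank_mmSupport_le
      (Λ := {q : (∀ d, I (ℓ d)) × (∀ d, J (ℓ d)) × (∀ d, K (ℓ d)) |
        ∀ d, (q.1 d, q.2.1 d, q.2.2 d) ∈ Λ (ℓ d)}) hU ?_ f g e hs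
      (l := A) (m := B) (n := C) (by simpa using hA) (by simpa using hB) (by simpa using hC)
    · simpa [M] using hfin
    · intro x y y' z z' x'
      simp only [copies, and_self, if_true, kronPow, hT, typeBlock, Finset.prod_ne_zero_iff,
        Finset.mem_univ, true_implies, ht', mem_famPMMSumSupport_iff]
      constructor
      · intro h
        exact ⟨funext fun d => (h d.1 d.2.1 d.2.2).1, funext fun d => (h d.1 d.2.1 d.2.2).2.1,
          funext fun d => (h d.1 d.2.1 d.2.2).2.2.1, fun d => (h d.1 d.2.1 d.2.2).2.2.2⟩
      · rintro ⟨rfl, rfl, rfl, h⟩ j d s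
        exact ⟨rfl, rfl, rfl, h (j, d, s)⟩

end Family

/-! ### Asymptotics -/

lemma mul_log_sub_le_log_factorial (n : ℕ) :
    (n : ℝ) * Real.log n - n ≤ Real.log n.factorial := by
  rcases Nat.eq_zero_or_pos n with rfl | hn
  · simp
  have h := Real.pow_div_factorial_le_exp (n : ℝ) (by positivity) n
  have h2 := Real.log_le_log (by positivity) h
  rw [Real.log_exp, Real.log_div (by positivity) (by positivity), Real.log_pow] at h2
  linarith

lemma log_factorial_le (n : ℕ) :
    Real.log n.factorial ≤ ((n : ℝ) + 1) * Real.log (n + 1) - n := by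
  induction n with
  | zero => simp
  | succ n ih =>
    have h1 : Real.log (n + 1).factorial = Real.log (n + 1) + Real.log n.factorial := by
      rw [Nat.factorial_succ]
      push_cast
      exact Real.log_mul (by positivity) (by positivity)
    have h2 := Real.one_sub_inv_le_log_of_pos (x := ((n : ℝ) + 2) / (n + 1)) (by positivity)
    rw [Real.log_div (by positivity) (by positivity), inv_div] at h2
    have h3 : ((n : ℝ) + 2) * (1 - (n + 1) / (n + 2)) = 1 := by
      field_simp
      ring
    have h4 := mul_le_mul_of_nonneg_left h2 (by positivity : (0 : ℝ) ≤ (n : ℝ) + 2)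
    rw [h3] at h4
    have h5 : ((n + 1 : ℕ) : ℝ) + 1 = n + 2 := by push_cast; ring
    rw [h1, h5]
    push_cast
    linarith

section WordDistribution

variable {p : ℕ} {Q : Fin p → ℝ}

/-- The product distribution on words of length `N`. -/
def wordProb (Q : Fin p → ℝ) (N : ℕ) (σ : Fin N → Fin p) : ℝ := ∏ s, Q (σ s)

/-- The rounded type of the product distribution, at scale `x`. -/
noncomputable def roundedType (Q : Fin p → ℝ) (N x : ℕ) (σ : Fin N → Fin p) : ℕ :=
  ⌊wordProb Q N σ * x⌋₊

lemma wordProb_nonneg (hQ0 : ∀ i, 0 ≤ Q i) (N : ℕ) (σ : Fin N → Fin p) : 0 ≤ wordProb Q N σ :=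
  Finset.prod_nonneg fun _ _ => hQ0 _

lemma sum_wordProb (hQ1 : ∑ i, Q i = 1) (N : ℕ) : ∑ σ, wordProb Q N σ = 1 := by
  have h := Finset.prod_univ_sum (fun _ : Fin N => (Finset.univ : Finset (Fin p)))
    (fun _ i => Q i)
  simp only [hQ1, Finset.prod_const_one, Fintype.piFinset_univ] at h
  exact h.symm

lemma sum_wordProb_mul (hQ1 : ∑ i, Q i = 1) {N : ℕ} (s₀ : Fin N) (φ : Fin p → ℝ) :
    ∑ σ, wordProb Q N σ * φ (σ s₀) = ∑ i, Q i * φ i := by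
  have h := Finset.prod_univ_sum (fun _ : Fin N => (Finset.univ : Finset (Fin p)))
    (fun s i => Q i * if s = s₀ then φ i else 1)
  simp only [Finset.prod_mul_distrib, Finset.prod_ite_eq', Finset.mem_univ, if_true,
    Fintype.piFinset_univ] at h
  change _ = ∑ σ, wordProb Q N σ * φ (σ s₀) at h
  rw [← h, Finset.prod_eq_single s₀]
  · simp
  · intro s _ hs
    simp [hs, hQ1]
  · simp

lemma sum_wordProb_mul_log (hQ1 : ∑ i, Q i = 1) (N : ℕ) :
    ∑ σ, wordProb Q N σ * Real.log (wordProb Q N σ) = N * ∑ i, Q i * Real.log (Q i) := by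
  have h : ∀ σ, wordProb Q N σ * Real.log (wordProb Q N σ) =
      ∑ s, wordProb Q N σ * Real.log (Q (σ s)) := by
    intro σ
    by_cases h0 : wordProb Q N σ = 0
    · simp [h0]
    · rw [← Finset.mul_sum]
      congr 1
      exact Real.log_prod fun s hs => Finset.prod_ne_zero_iff.1 h0 s hs
  simp only [h]
  rw [Finset.sum_comm]
  simp [sum_wordProb_mul hQ1 _ fun i => Real.log (Q i)]

lemma sum_wordProb_mul_card (hQ1 : ∑ i, Q i = 1) (N : ℕ) (i : Fin p) :
    ∑ σ, wordProb Q N σ * (Fintype.card {s // σ s = i} : ℝ) = N * Q i := by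
  have h : ∀ σ : Fin N → Fin p, wordProb Q N σ * (Fintype.card {s // σ s = i} : ℝ) =
      ∑ s, wordProb Q N σ * if σ s = i then 1 else 0 := by
    intro σ
    rw [← Finset.mul_sum, Fintype.card_subtype]
    simp
  simp only [h]
  rw [Finset.sum_comm]
  simp only [sum_wordProb_mul hQ1 _ fun j => if j = i then (1 : ℝ) else 0]
  simp

open Filter Topology

lemma tendsto_roundedType (hQ0 : ∀ i, 0 ≤ Q i) (N : ℕ) (σ : Fin N → Fin p) :
    Tendsto (fun x : ℕ => (roundedType Q N x σ : ℝ) / x) atTop (𝓝 (wordProb Q N σ)) :=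
  (tendsto_nat_floor_mul_div_atTop (wordProb_nonneg hQ0 N σ)).comp tendsto_natCast_atTop_atTop

lemma tendsto_sum_roundedType (hQ0 : ∀ i, 0 ≤ Q i) (hQ1 : ∑ i, Q i = 1) (N : ℕ) :
    Tendsto (fun x : ℕ => ((∑ σ, roundedType Q N x σ : ℕ) : ℝ) / x) atTop (𝓝 1) := by
  rw [← sum_wordProb hQ1 N]
  simp only [Nat.cast_sum, Finset.sum_div]
  exact tendsto_finsetSum _ fun σ _ => tendsto_roundedType hQ0 N σ

lemma tendsto_letterCount (hQ0 : ∀ i, 0 ≤ Q i) (hQ1 : ∑ i, Q i = 1) (N : ℕ) (i : Fin p) :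
    Tendsto (fun x : ℕ => (letterCount (roundedType Q N x) i : ℝ) / x) atTop (𝓝 (N * Q i)) := by
  rw [← sum_wordProb_mul_card hQ1 N i]
  simp only [letterCount, Nat.cast_sum, Finset.sum_div, Nat.cast_mul]
  refine tendsto_finsetSum _ fun σ _ => ?_
  simp only [mul_div_right_comm]
  exact (tendsto_roundedType hQ0 N σ).mul_const _

/-- The logarithmic lower bound for multinomial coefficients obtained from Stirling's bounds. -/
noncomputable def multinomialBound {S : Type*} [Fintype S] (n : S → ℕ) : ℝ :=
  ((∑ σ, n σ : ℕ) : ℝ) * Real.log (∑ σ, n σ : ℕ) -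
    ∑ σ, ((n σ : ℝ) + 1) * Real.log ((n σ : ℝ) + 1)

lemma multinomialBound_le_log {S : Type*} [Fintype S] {n : S → ℕ} {M : ℕ} (hM : 0 < M)
    (h : (∑ σ, n σ).factorial ≤ M * ∏ σ, (n σ).factorial) :
    multinomialBound n ≤ Real.log M := by
  have h1 : Real.log (∑ σ, n σ).factorial ≤ Real.log M + ∑ σ, Real.log (n σ).factorial := by
    rw [← Real.log_prod fun σ _ => by positivity, ← Real.log_mul (by positivity)
      (Finset.prod_ne_zero_iff.2 fun σ _ => by positivity)]
    exact Real.log_le_log (by positivity) (by exact_mod_cast h)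
  have h2 := mul_log_sub_le_log_factorial (∑ σ, n σ)
  have h3 : ∑ σ, Real.log (n σ).factorial ≤
      ∑ σ, (((n σ : ℝ) + 1) * Real.log (n σ + 1) - n σ) :=
    Finset.sum_le_sum fun σ _ => log_factorial_le (n σ)
  rw [Finset.sum_sub_distrib] at h3
  have h4 : ((∑ σ, n σ : ℕ) : ℝ) = ∑ σ, (n σ : ℝ) := by push_cast; rfl
  unfold multinomialBound
  linarith

lemma mul_log_div {x y : ℝ} (hx : 0 < x) :
    y * Real.log y / x = y / x * Real.log (y / x) + y / x * Real.log x := by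
  by_cases hy : y = 0
  · simp [hy]
  · rw [Real.log_div hy hx.ne']
    ring

lemma tendsto_multinomialBound (hQ0 : ∀ i, 0 ≤ Q i) (hQ1 : ∑ i, Q i = 1) (N : ℕ) :
    Tendsto (fun x : ℕ => multinomialBound (roundedType Q N x) / x) atTop
      (𝓝 (-(N * ∑ i, Q i * Real.log (Q i)))) := by
  have hlog : Tendsto (fun x : ℕ => Real.log x / x) atTop (𝓝 0) :=
    Real.isLittleO_log_id_atTop.tendsto_div_nhds_zero.comp tendsto_natCast_atTop_atTop
  have hc := Real.continuous_mul_log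
  have h1 := (hc.tendsto 1).comp (tendsto_sum_roundedType hQ0 hQ1 N)
  have h2 : ∀ σ : Fin N → Fin p, Tendsto (fun x : ℕ => ((roundedType Q N x σ : ℝ) + 1) / x) atTop
      (𝓝 (wordProb Q N σ)) := by
    intro σ
    simpa [add_div] using (tendsto_roundedType hQ0 N σ).add tendsto_one_div_atTop_nhds_zero_nat
  have h3 := tendsto_finsetSum Finset.univ fun σ _ => (hc.tendsto _).comp (h2 σ)
  have h4 := (h1.sub h3).sub (hlog.const_mul (Fintype.card (Fin N → Fin p) : ℝ))
  rw [sum_wordProb_mul_log hQ1] at h4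
  simp only [Real.log_one, mul_zero, sub_zero, zero_sub] at h4
  refine h4.congr' ?_
  filter_upwards [eventually_gt_atTop 0] with x hx
  have hx' : (0 : ℝ) < x := by exact_mod_cast hx
  have h5 : ∑ σ, ((roundedType Q N x σ : ℝ) + 1) / x * Real.log x =
      ((∑ σ, roundedType Q N x σ : ℕ) : ℝ) / x * Real.log x +
        (Fintype.card (Fin N → Fin p) : ℝ) * (Real.log x / x) := by
    rw [← Finset.sum_mul, ← Finset.sum_div, Finset.sum_add_distrib, Finset.sum_const,
      nsmul_eq_mul, Finset.card_univ]
    push_cast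
    ring
  simp only [multinomialBound, sub_div, Finset.sum_div, mul_log_div hx', Function.comp,
    Finset.sum_add_distrib]
  rw [h5]
  ring

end WordDistribution

lemma rpow_sub_one_le_floor {y : ℝ} (hy : 0 ≤ y) : (2 : ℝ) ^ (y - 1) ≤ ⌊(2 : ℝ) ^ y⌋₊ := by
  have h1 : (1 : ℝ) ≤ 2 ^ y := Real.one_le_rpow (by norm_num) hy
  have h2 : (1 : ℝ) ≤ ⌊(2 : ℝ) ^ y⌋₊ := by exact_mod_cast (Nat.one_le_floor_iff _).2 h1
  have h3 := Nat.lt_floor_add_one ((2 : ℝ) ^ y)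
  rw [Real.rpow_sub_one (by norm_num)]
  linarith

section Limits

open Filter Topology

lemma eventually_floor_le_prod_floor {p : ℕ} {a κ : ℝ} {v : Fin p → ℝ}
    (hv : ∀ i, 0 ≤ v i) (m : Fin p → ℕ) (ha : 0 < a → a < κ * ∑ i, v i * m i) :
    ∀ᶠ ν : ℕ in atTop, ⌊(2 : ℝ) ^ (a * ν)⌋₊ ≤
      ∏ i, ⌊(2 : ℝ) ^ (v i * (⌈κ * ν⌉₊ * m i : ℕ))⌋₊ := by
  rcases le_or_gt a 0 with h0 | h0
  · refine Eventually.of_forall fun ν => ?_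
    have h1 : ⌊(2 : ℝ) ^ (a * ν)⌋₊ ≤ 1 := by
      refine Nat.floor_le_one_of_le_one (Real.rpow_le_one_of_one_le_of_nonpos (by norm_num) ?_)
      exact mul_nonpos_of_nonpos_of_nonneg h0 (by positivity)
    refine h1.trans (Nat.one_le_iff_ne_zero.2 (Finset.prod_ne_zero_iff.2 fun i _ => ?_))
    refine Nat.one_le_iff_ne_zero.1 ((Nat.one_le_floor_iff _).2 ?_)
    exact Real.one_le_rpow (by norm_num) (mul_nonneg (hv i) (by positivity))
  · specialize ha h0
    have hlim : Tendsto (fun ν : ℕ => (κ * ∑ i, v i * m i - a) * (ν : ℝ)) atTop atTop :=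
      tendsto_natCast_atTop_atTop.const_mul_atTop (by linarith)
    filter_upwards [hlim.eventually_ge_atTop (p : ℝ)] with ν hν
    have h1 : ∏ i, (2 : ℝ) ^ (v i * (⌈κ * ν⌉₊ * m i : ℕ) - 1) ≤
        ((∏ i, ⌊(2 : ℝ) ^ (v i * (⌈κ * ν⌉₊ * m i : ℕ))⌋₊ : ℕ) : ℝ) := by
      rw [Nat.cast_prod]
      exact Finset.prod_le_prod (fun i _ => by positivity) fun i _ =>
        rpow_sub_one_le_floor (mul_nonneg (hv i) (by positivity))
    rw [← Real.rpow_sum_of_pos (by norm_num)] at h1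
    refine Nat.floor_le_of_le (le_trans ?_ h1)
    refine Real.rpow_le_rpow_of_exponent_le (by norm_num) ?_
    have h2 : κ * ν * ∑ i, v i * m i ≤ ⌈κ * ν⌉₊ * ∑ i, v i * m i :=
      mul_le_mul_of_nonneg_right (Nat.le_ceil _)
        (Finset.sum_nonneg fun i _ => mul_nonneg (hv i) (by positivity))
    have h3 : ∑ i, (v i * (⌈κ * ν⌉₊ * m i : ℕ) - 1) = ⌈κ * ν⌉₊ * ∑ i, v i * m i - p := by
      rw [Finset.sum_sub_distrib, Finset.mul_sum]
      simp only [Finset.sum_const, Finset.card_univ, Fintype.card_fin, nsmul_eq_mul, mul_one]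
      congr 1
      refine Finset.sum_congr rfl fun i _ => ?_
      push_cast
      ring
    rw [h3]
    nlinarith

lemma logb_natCast_nonneg (n : ℕ) : 0 ≤ Real.logb 2 n := by
  rcases Nat.eq_zero_or_pos n with rfl | hn
  · simp
  · exact Real.logb_nonneg (by norm_num) (by exact_mod_cast hn)

lemma logb_natCast_le {R c M k r : ℕ} (hM : 0 < M) (hMr : M ≤ r) (hc : c = r / M + 1)
    (hR : R ≤ c ^ k * M) :
    Real.logb 2 R ≤ k * (1 + Real.logb 2 r - Real.logb 2 M) + Real.logb 2 M := by
  have hr : 0 < r := hM.trans_le hMr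
  have hM' : (0 : ℝ) < M := by exact_mod_cast hM
  have hr' : (0 : ℝ) < r := by exact_mod_cast hr
  have hcpos : 0 < c := hc ▸ Nat.succ_pos _
  have hc' : (0 : ℝ) < c := by exact_mod_cast hcpos
  have h1 : (c : ℝ) ≤ 2 * (r / M) := by
    have e1 : ((r / M : ℕ) : ℝ) ≤ r / M := Nat.cast_div_le
    have e2 : (1 : ℝ) ≤ r / M := by
      rw [le_div_iff₀ hM', one_mul]
      exact_mod_cast hMr
    rw [hc]
    push_cast
    linarith
  have h2 : Real.logb 2 c ≤ 1 + Real.logb 2 r - Real.logb 2 M := by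
    refine (Real.logb_le_logb_of_le (by norm_num) hc' h1).trans (le_of_eq ?_)
    rw [Real.logb_mul (by norm_num) (by positivity), Real.logb_div (by positivity) (by positivity),
      Real.logb_self_eq_one (by norm_num)]
    ring
  have h3 : Real.logb 2 R ≤ Real.logb 2 ((c ^ k * M : ℕ) : ℝ) := by
    rcases Nat.eq_zero_or_pos R with rfl | hRpos
    · simpa using logb_natCast_nonneg (c ^ k * M)
    · exact Real.logb_le_logb_of_le (by norm_num) (by exact_mod_cast hRpos) (by exact_mod_cast hR)
  refine h3.trans ?_
  rw [Nat.cast_mul, Nat.cast_pow, Real.logb_mul (by positivity) (by positivity), Real.logb_pow]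
  gcongr

lemma omegaS_le_of_eventually (F : Type*) [Field F] {a b c κ G H : ℝ} (hκ : 0 < κ)
    (h : ∀ᶠ ν : ℕ in atTop, Real.logb 2 (SupportRank F (MMSupport ⌊(2 : ℝ) ^ (a * ν)⌋₊
      ⌊(2 : ℝ) ^ (b * ν)⌋₊ ⌊(2 : ℝ) ^ (c * ν)⌋₊)) ≤ ⌈κ * ν⌉₊ * G + H) :
    omegaS F a b c ≤ κ * G := by
  have hceil : Tendsto (fun ν : ℕ => (⌈κ * ν⌉₊ : ℝ) / ν) atTop (𝓝 κ) :=
    (tendsto_nat_ceil_mul_div_atTop hκ.le).comp tendsto_natCast_atTop_atTop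
  have hlim : Tendsto (fun ν : ℕ => (⌈κ * ν⌉₊ : ℝ) / ν * G + H * (1 / ν)) atTop
      (𝓝 (κ * G)) := by
    simpa using (hceil.mul_const G).add (tendsto_one_div_atTop_nhds_zero_nat.const_mul H)
  rw [← hlim.limsup_eq]
  refine limsup_le_limsup ?_ ?_ hlim.isBoundedUnder_le
  · filter_upwards [h] with ν hν
    calc (1 / ν : ℝ) * _ ≤ (1 / ν : ℝ) * (⌈κ * ν⌉₊ * G + H) :=
          mul_le_mul_of_nonneg_left hν (by positivity)
      _ = _ := by ring
  · exact IsBoundedUnder.isCoboundedUnder_le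
      (isBoundedUnder_of ⟨0, fun ν => mul_nonneg (by positivity) (logb_natCast_nonneg _)⟩)

lemma exists_achievable_near {p : ℕ} {I J K : Fin p → Type*} {Λ : ∀ i, Set (I i × J i × K i)}
    {u : Fin p → ℝ × ℝ × ℝ} (hu : ∀ i, u i ∈ CapacityRegion (Λ i)) {Q : Fin p → ℝ} {a b c ε : ℝ}
    (hε : 0 < ε) (habc : (a, b, c) = ∑ i, Q i • u i) :
    ∃ u' : Fin p → ℝ × ℝ × ℝ, (∀ i, Achievable (Λ i) (u' i)) ∧
      (0 < a → a < (1 + ε) * ∑ i, (u' i).1 * Q i) ∧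
      (0 < b → b < (1 + ε) * ∑ i, (u' i).2.1 * Q i) ∧
      (0 < c → c < (1 + ε) * ∑ i, (u' i).2.2 * Q i) := by
  have hcl : u ∈ closure (Set.univ.pi fun i => {r | Achievable (Λ i) r}) := by
    rw [closure_pi_set]
    exact fun i _ => hu i
  have near : ∀ (φ : ℝ × ℝ × ℝ → ℝ), Continuous φ → ∀ s, s = ∑ i, φ (u i) * Q i →
      ∀ᶠ u' : Fin p → ℝ × ℝ × ℝ in 𝓝 u, 0 < s → s < (1 + ε) * ∑ i, φ (u' i) * Q i := by
    intro φ hφ s hs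
    rcases le_or_gt s 0 with h0 | h0
    · exact Eventually.of_forall fun _ h => absurd h h0.not_gt
    · have hcont : Continuous fun u' : Fin p → ℝ × ℝ × ℝ => (1 + ε) * ∑ i, φ (u' i) * Q i := by
        fun_prop
      have : s < (1 + ε) * ∑ i, φ (u i) * Q i := by
        rw [← hs]
        nlinarith
      filter_upwards [hcont.continuousAt.eventually (lt_mem_nhds this)] with u' h _ using h
  have h1 := near (fun r => r.1) (by fun_prop) a (by
    have := congrArg Prod.fst habc
    simpa [Prod.fst_sum, mul_comm] using this)
  have h2 := near (fun r => r.2.1) (by fun_prop) b (by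
    have := congrArg (fun r => r.2.1) habc
    simpa [Prod.fst_sum, Prod.snd_sum, mul_comm] using this)
  have h3 := near (fun r => r.2.2) (by fun_prop) c (by
    have := congrArg (fun r => r.2.2) habc
    simpa [Prod.snd_sum, mul_comm] using this)
  obtain ⟨u', hu', h⟩ := ((mem_closure_iff_frequently.1 hcl).and_eventually
    (h1.and (h2.and h3))).exists
  exact ⟨u', fun i => hu' i (Set.mem_univ i), h⟩

end Limits

lemma supportRank_pos (F : Type*) [Field F] {I J K : Type*} [Finite I] [Finite J] [Finite K]
    {Φ : Set (I × J × K)} (h : Φ.Nonempty) : 0 < SupportRank F Φ := by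
  obtain ⟨t, ht, a, b, c, hd⟩ := exists_hasDecomp_supportRank (F := F) Φ
  obtain ⟨⟨x, y, z⟩, hq⟩ := h
  have hne : t (x, y, z) ≠ 0 := (Set.ext_iff.1 ht _).2 hq
  by_contra h0
  have : IsEmpty (Fin (SupportRank F Φ)) := by
    rw [Nat.eq_zero_of_not_pos h0]
    infer_instance
  exact hne (by rw [hd]; simp)

section SumInequality

open Filter Topology

variable {F : Type*} [Field F] [Infinite F] {p : ℕ} {I J K : Fin p → Type*}
  [∀ i, Fintype (I i)] [∀ i, Fintype (J i)] [∀ i, Fintype (K i)]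
  {Λ : ∀ i, Set (I i × J i × K i)} {Q : Fin p → ℝ} {a b c : ℝ}

lemma omegaS_le_of_rounding (hΛ : ∀ i, (Λ i).Nonempty) {N : ℕ} (hN : 0 < N)
    {u : Fin p → ℝ × ℝ × ℝ} (hu : ∀ i, Achievable (Λ i) (u i)) {ε : ℝ} (hε : 0 < ε)
    (n : (Fin N → Fin p) → ℕ) {x : ℕ} (hx : 0 < x)
    (ha : 0 < a → a < (1 + ε) / (N * x) * ∑ i, (u i).1 * letterCount n i)
    (hb : 0 < b → b < (1 + ε) / (N * x) * ∑ i, (u i).2.1 * letterCount n i)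
    (hc : 0 < c → c < (1 + ε) / (N * x) * ∑ i, (u i).2.2 * letterCount n i) :
    omegaS F a b c ≤ (1 + ε) / (N * x) * (1 + (∑ σ, n σ : ℕ) *
      Real.logb 2 (SupportRank F (PowSupport (FamPMMSumSupport Λ) N)) -
        multinomialBound n / Real.log 2) := by
  have hκ : 0 < (1 + ε) / (N * x) := by positivity
  obtain ⟨M, hM, hfac, hMr, hrank⟩ := exists_supportRank_mmSupport_le F hΛ N hu n
  have h1 : multinomialBound n / Real.log 2 ≤ Real.logb 2 M :=
    div_le_div_of_nonneg_right (multinomialBound_le_log hM hfac) (Real.log_nonneg (by norm_num))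
  have h2 := omegaS_le_of_eventually F (a := a) (b := b) (c := c) (G := 1 + Real.logb 2
    ((SupportRank F (PowSupport (FamPMMSumSupport Λ) N) ^ ∑ σ, n σ : ℕ) : ℝ) - Real.logb 2 M)
    (H := Real.logb 2 M) hκ (by
      filter_upwards [eventually_floor_le_prod_floor (fun i => (hu i).1) (letterCount n) ha,
        eventually_floor_le_prod_floor (fun i => (hu i).2.1) (letterCount n) hb,
        eventually_floor_le_prod_floor (fun i => (hu i).2.2.1) (letterCount n) hc]
        with ν hA hB hC
      exact logb_natCast_le hM hMr rfl (hrank _ _ _ _ hA hB hC))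
  refine h2.trans (mul_le_mul_of_nonneg_left ?_ hκ.le)
  rw [Nat.cast_pow, Real.logb_pow]
  linarith

lemma omegaS_le_supportRank_pow (hΛ : ∀ i, (Λ i).Nonempty) (hQ0 : ∀ i, 0 ≤ Q i)
    (hQ1 : ∑ i, Q i = 1) {u : Fin p → ℝ × ℝ × ℝ} (hu : ∀ i, u i ∈ CapacityRegion (Λ i))
    (habc : (a, b, c) = ∑ i, Q i • u i) {N : ℕ} (hN : 0 < N) :
    omegaS F a b c ≤ (1 / N : ℝ) *
      Real.logb 2 (SupportRank F (PowSupport (FamPMMSumSupport Λ) N)) +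
        ∑ i, Q i * Real.logb 2 (Q i) := by
  set ρ := Real.logb 2 (SupportRank F (PowSupport (FamPMMSumSupport Λ) N)) with hρ
  have hN' : (0 : ℝ) < N := by exact_mod_cast hN
  have hεbound : ∀ ε : ℝ, 0 < ε → omegaS F a b c ≤ (1 + ε) * ((1 / N : ℝ) * ρ +
        ∑ i, Q i * Real.logb 2 (Q i)) := by
    intro ε hε
    obtain ⟨u', hu', ha, hb, hc⟩ := exists_achievable_near hu hε habc
    have hcount : ∀ (v : Fin p → ℝ) (s : ℝ), (0 < s → s < (1 + ε) * ∑ i, v i * Q i) →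
        ∀ᶠ x : ℕ in atTop, 0 < s → s < (1 + ε) / (N * x) *
          ∑ i, v i * letterCount (roundedType Q N x) i := by
      intro v s hs
      rcases le_or_gt s 0 with h0 | h0
      · exact Eventually.of_forall fun _ h => absurd h h0.not_gt
      · have hlim : Tendsto (fun x : ℕ => (1 + ε) / N *
            ∑ i, v i * ((letterCount (roundedType Q N x) i : ℝ) / x)) atTop
            (𝓝 ((1 + ε) / N * ∑ i, v i * (N * Q i))) :=
          (tendsto_finsetSum _ fun i _ =>
            (tendsto_letterCount hQ0 hQ1 N i).const_mul (v i)).const_mul _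
        have hval : (1 + ε) / N * ∑ i, v i * (N * Q i) = (1 + ε) * ∑ i, v i * Q i := by
          rw [Finset.mul_sum, Finset.mul_sum]
          refine Finset.sum_congr rfl fun i _ => ?_
          field_simp
        rw [hval] at hlim
        filter_upwards [hlim.eventually (lt_mem_nhds (hs h0))] with x hx _
        refine hx.trans_eq ?_
        rw [Finset.mul_sum, Finset.mul_sum]
        refine Finset.sum_congr rfl fun i _ => ?_
        rw [← div_div]
        ring
    have hlim : Tendsto (fun x : ℕ => (1 + ε) / N * (1 / (x : ℝ) +
        ((∑ σ, roundedType Q N x σ : ℕ) : ℝ) / x * ρ -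
          multinomialBound (roundedType Q N x) / x / Real.log 2)) atTop
        (𝓝 ((1 + ε) / N * (0 + 1 * ρ -
          -(N * ∑ i, Q i * Real.log (Q i)) / Real.log 2))) :=
      ((tendsto_one_div_atTop_nhds_zero_nat.add
        ((tendsto_sum_roundedType hQ0 hQ1 N).mul_const ρ)).sub
        ((tendsto_multinomialBound hQ0 hQ1 N).div_const _)).const_mul _
    have hval : (1 + ε) / N * (0 + 1 * ρ - -(N * ∑ i, Q i * Real.log (Q i)) / Real.log 2) =
        (1 + ε) * ((1 / N : ℝ) * ρ + ∑ i, Q i * Real.logb 2 (Q i)) := by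
      simp only [Real.logb, ← mul_div_assoc, ← Finset.sum_div]
      field_simp
      ring
    rw [hval] at hlim
    refine ge_of_tendsto hlim ?_
    filter_upwards [hcount _ a ha, hcount _ b hb, hcount _ c hc, eventually_gt_atTop 0]
      with x hxa hxb hxc hx
    refine (omegaS_le_of_rounding hΛ hN hu' hε _ hx hxa hxb hxc).trans_eq ?_
    rw [← div_div]
    ring
  have hlim : Tendsto (fun ε : ℝ => (1 + ε) * ((1 / N : ℝ) * ρ +
      ∑ i, Q i * Real.logb 2 (Q i))) (𝓝[>] 0) (𝓝 ((1 + 0) * ((1 / N : ℝ) * ρ +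
      ∑ i, Q i * Real.logb 2 (Q i)))) :=
    ((continuous_const.add continuous_id).mul continuous_const).continuousWithinAt
  rw [add_zero, one_mul] at hlim
  exact ge_of_tendsto hlim (eventually_mem_nhdsWithin.mono fun ε hε => hεbound ε hε)

end SumInequality

theorem asymptotic_sum_inequality_rates
    (F : Type*) [Field F] [Infinite F]
    (p : ℕ) (hp : 0 < p)
    (I J K : Fin p → Type*)
    [∀ i, Fintype (I i)] [∀ i, Fintype (J i)] [∀ i, Fintype (K i)]
    (Λ : ∀ i, Set (I i × J i × K i)) (hΛ : ∀ i, (Λ i).Nonempty)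
    (Q : Fin p → ℝ) (hQ0 : ∀ i, 0 ≤ Q i) (hQ1 : ∑ i, Q i = 1)
    (a b c : ℝ)
    (hmem : ∃ u : Fin p → ℝ × ℝ × ℝ,
      (∀ i, u i ∈ CapacityRegion (Λ i)) ∧ (a, b, c) = ∑ i, Q i • u i) :
    omegaS F a b c ≤
      Real.logb 2 (AsymptoticSupportRank F (FamPMMSumSupport Λ)) -
        (-∑ i, Q i * Real.logb 2 (Q i)) := by
  obtain ⟨u, hu, habc⟩ := hmem
  have hne : ∀ N, (PowSupport (FamPMMSumSupport Λ) N).Nonempty := by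
    intro N
    obtain ⟨⟨x, y, z⟩, hq⟩ := hΛ ⟨0, hp⟩
    exact ⟨(fun _ => ⟨_, (x, y)⟩, fun _ => ⟨_, (y, z)⟩, fun _ => ⟨_, (z, x)⟩),
      fun _ => ⟨_, x, y, z, hq, rfl⟩⟩
  set H := ∑ i, Q i * Real.logb 2 (Q i) with hH
  have key : (2 : ℝ) ^ (omegaS F a b c - H) ≤ AsymptoticSupportRank F (FamPMMSumSupport Λ) := by
    refine le_csInf ⟨_, 1, one_pos, rfl⟩ ?_
    rintro _ ⟨N, hN, rfl⟩
    have hpos : (0 : ℝ) < SupportRank F (PowSupport (FamPMMSumSupport Λ) N) := by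
      exact_mod_cast supportRank_pos F (hne N)
    have hle := omegaS_le_supportRank_pow (F := F) hΛ hQ0 hQ1 hu habc hN
    rw [← Real.le_logb_iff_rpow_le (by norm_num) (by positivity),
      Real.logb_rpow_eq_mul_logb_of_pos hpos]
    linarith
  have hlog := (Real.le_logb_iff_rpow_le (by norm_num)
    ((Real.rpow_pos_of_pos two_pos _).trans_le key)).2 key
  linarith
end

section
/- Let F be a field and let Λ = {(1,1,2),(1,2,1),(2,1,1),(2,2,1),(2,1,2),(1,2,2)} ⊆ [2] × [2] × [2]. In the polynomial ring F[ε], consider the trilinear form in variables x_{i,j}, y_{j,k}, z_{k,i} (i,j,k ∈ [2]) given by S(ε) = x_{1,2}y_{1,2}z_{1,2} − (x_{1,2}+ε²x_{2,1})(y_{1,2}+ε²y_{2,1})(z_{1,2}+ε²z_{2,1}) + ε²x_{2,1}(y_{1,2}+εy_{1,1})(z_{1,2}+εz_{2,2}) + ε²(x_{1,2}+εx_{2,2})y_{2,1}(z_{1,2}+εz_{1,1}) + ε²(x_{1,2}+εx_{1,1})(y_{1,2}+εy_{2,2})z_{2,1}. Then every coefficient of the trilinear form S(ε) − ε³·T_Λ,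 where T_Λ = Σ_{(i,j,k) ∈ Λ} x_{i,j} y_{j,k} z_{k,i}, is a polynomial in ε divisible by ε⁴. Consequently, for each nonzero ε the form S(ε) is a sum of 5 products of linear forms, and the border rank of the partial matrix multiplication tensor T_Λ is at most 5. -/
open scoped BigOperators
open Polynomial

/-- The support of the partial matrix multiplication tensor with pattern `Λ`. -/
def PMMSupport {I J K : Type*} (Λ : Set (I × J × K)) :
    Set ((I × J) × (J × K) × (K × I)) :=
  {q | ∃ i j k, (i, j, k) ∈ Λ ∧ q = ((i, j), (j, k), (k, i))}

/-- Algebraic (Bini-style) witness that the border rank of `t` is at most `r`: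
there is a curve of tensors, given by `r` products of linear forms with polynomial
coefficients, equal to `ε^h · t + O(ε^{h+1})`. -/
def BorderRankLe (F : Type*) [Field F] {I J K : Type*} (t : I × J × K → F) (r : ℕ) : Prop :=
  ∃ (h : ℕ) (a : Fin r → I → Polynomial F) (b : Fin r → J → Polynomial F)
    (c : Fin r → K → Polynomial F),
    ∀ q : I × J × K,
      (X : Polynomial F) ^ (h + 1) ∣
        ((∑ m, a m q.1 * b m q.2.1 * c m q.2.2) - Polynomial.C (t q) * X ^ h)

/-- The pattern `Λ = {(1,1,2),(1,2,1),(2,1,1),(2,2,1),(2,1,2),(1,2,2)}`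
(written with 0-based indices). -/
def Λex : Set (Fin 2 × Fin 2 × Fin 2) :=
  {(0, 0, 1), (0, 1, 0), (1, 0, 0), (1, 1, 0), (1, 0, 1), (0, 1, 1)}

/-- The partial matrix multiplication tensor `T_Λ` of the pattern `Λex`,
with all nonzero coefficients equal to `1`. -/
noncomputable def Tex (F : Type*) [Field F] :
    (Fin 2 × Fin 2) × (Fin 2 × Fin 2) × (Fin 2 × Fin 2) → F :=
  (PMMSupport Λex).indicator 1

/-- Indicator linear form `δ p`. -/
noncomputable def δP (F : Type*) [Field F] (p : Fin 2 × Fin 2) :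
    Fin 2 × Fin 2 → Polynomial F :=
  fun q => if q = p then 1 else 0

/-- The signs of the five terms of the border decomposition. -/
noncomputable def sgn (F : Type*) [Field F] : Fin 5 → Polynomial F := ![1, -1, 1, 1, 1]

/-- The `x`-linear forms of the five terms (`x_{1,2}` is written `(0,1)`, etc.). -/
noncomputable def xLin (F : Type*) [Field F] : Fin 5 → (Fin 2 × Fin 2) → Polynomial F :=
  ![δP F (0, 1),
    fun q => δP F (0, 1) q + X ^ 2 * δP F (1, 0) q,
    fun q => X ^ 2 * δP F (1, 0) q,
    fun q => X ^ 2 * (δP F (0, 1) q + X * δP F (1, 1) q),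
    fun q => X ^ 2 * (δP F (0, 1) q + X * δP F (0, 0) q)]

/-- The `y`-linear forms of the five terms. -/
noncomputable def yLin (F : Type*) [Field F] : Fin 5 → (Fin 2 × Fin 2) → Polynomial F :=
  ![δP F (0, 1),
    fun q => δP F (0, 1) q + X ^ 2 * δP F (1, 0) q,
    fun q => δP F (0, 1) q + X * δP F (0, 0) q,
    δP F (1, 0),
    fun q => δP F (0, 1) q + X * δP F (1, 1) q]

/-- The `z`-linear forms of the five terms. -/
noncomputable def zLin (F : Type*) [Field F] : Fin 5 → (Fin 2 × Fin 2) → Polynomial F :=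
  ![δP F (0, 1),
    fun q => δP F (0, 1) q + X ^ 2 * δP F (1, 0) q,
    fun q => δP F (0, 1) q + X * δP F (1, 1) q,
    fun q => δP F (0, 1) q + X * δP F (0, 0) q,
    δP F (1, 0)]

/-- The curve of tensors
`S(ε) = x₁₂y₁₂z₁₂ − (x₁₂+ε²x₂₁)(y₁₂+ε²y₂₁)(z₁₂+ε²z₂₁) + ε²x₂₁(y₁₂+εy₁₁)(z₁₂+εz₂₂)
 + ε²(x₁₂+εx₂₂)y₂₁(z₁₂+εz₁₁) + ε²(x₁₂+εx₁₁)(y₁₂+εy₂₂)z₂₁`. -/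
noncomputable def Scurve (F : Type*) [Field F] :
    (Fin 2 × Fin 2) × (Fin 2 × Fin 2) × (Fin 2 × Fin 2) → Polynomial F :=
  fun q => ∑ m : Fin 5, sgn F m * xLin F m q.1 * yLin F m q.2.1 * zLin F m q.2.2

/-- The coefficients of `Tex`: the pattern `Λex` consists of the triples that are not constant. -/
theorem Tex_apply (F : Type*) [Field F] (i j j' k k' i' : Fin 2) :
    Tex F ((i, j), (j', k), (k', i')) =
      if j' = j ∧ k' = k ∧ i' = i ∧ ¬(i = j ∧ j = k) then 1 else 0 := by
  have mem_pattern_iff : (i, j, k) ∈ Λex ↔ ¬(i = j ∧ j = k) := by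
    simp only [Λex, Set.mem_insert_iff, Set.mem_singleton_iff]
    revert i j k
    decide
  have mem_iff : ((i, j), (j', k), (k', i')) ∈ PMMSupport Λex ↔
      j' = j ∧ k' = k ∧ i' = i ∧ ¬(i = j ∧ j = k) := by
    rw [← mem_pattern_iff]
    constructor
    · rintro ⟨_, _, _, hmem, heq⟩
      simp only [Prod.mk.injEq] at heq
      obtain ⟨⟨rfl, rfl⟩, ⟨rfl, rfl⟩, rfl, rfl⟩ := heq
      exact ⟨rfl, rfl, rfl, hmem⟩
    · rintro ⟨rfl, rfl, rfl, hmem⟩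
      exact ⟨_, _, _, hmem, rfl⟩
  classical
  simp only [Tex, Set.indicator_apply, mem_iff, Pi.one_apply]

/-- The curve `Scurve` agrees with `ε³ · T_Λ` up to terms of order `ε⁴`. -/
theorem X_pow_four_dvd_Scurve_sub (F : Type*) [Field F]
    (q : (Fin 2 × Fin 2) × (Fin 2 × Fin 2) × (Fin 2 × Fin 2)) :
    (X : Polynomial F) ^ 4 ∣ Scurve F q - Polynomial.C (Tex F q) * X ^ 3 := by
  obtain ⟨⟨i, j⟩, ⟨j', k⟩, ⟨k', i'⟩⟩ := q
  rw [Tex_apply]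
  fin_cases i <;> fin_cases j <;> fin_cases j' <;> fin_cases k <;> fin_cases k' <;>
    fin_cases i' <;>
    simp [Scurve, Fin.sum_univ_five, sgn, xLin, yLin, zLin, δP] <;>
    ring_nf <;> simp [pow_dvd_pow]

theorem border_rank_five_example (F : Type*) [Field F] :
    (∀ q : (Fin 2 × Fin 2) × (Fin 2 × Fin 2) × (Fin 2 × Fin 2),
      (X : Polynomial F) ^ 4 ∣ (Scurve F q - Polynomial.C (Tex F q) * X ^ 3)) ∧
    (∀ ε : F, ε ≠ 0 →
      ∃ (a b c : Fin 5 → (Fin 2 × Fin 2) → F),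
        ∀ q : (Fin 2 × Fin 2) × (Fin 2 × Fin 2) × (Fin 2 × Fin 2),
          (Scurve F q).eval ε = ∑ m, a m q.1 * b m q.2.1 * c m q.2.2) ∧
    BorderRankLe F (Tex F) 5 := by
  refine ⟨X_pow_four_dvd_Scurve_sub F, fun ε _ => ?_, ?_⟩
  · refine ⟨fun m p => (sgn F m * xLin F m p).eval ε, fun m p => (yLin F m p).eval ε,
      fun m p => (zLin F m p).eval ε, fun q => ?_⟩
    simp only [Scurve, eval_finsetSum, eval_mul]
  · exact ⟨3, fun m p => sgn F m * xLin F m p, yLin F, zLin F, X_pow_four_dvd_Scurve_sub F⟩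
end
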